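/- arXiv:1904.06636 — 4 statements merged into one kernel-verified Lean document; each statement's English description precedes it below -/
import Mathlib

section
/- Let R be a (not necessarily commutative) ring, let n ≥ 2, let a₁, …, aₙ ∈ R, and let ε ∈ {1, −1} be such that aᵢaⱼ = ε·aⱼaᵢ for all i ≠ j. Then the element (a₁ − a₂)(a₁ − a₃)⋯(a₁ − aₙ) − (−1)ⁿ·(a₁ − a₂)·a₃a₄⋯aₙ lies in the two-sided ideal of R generated by a₁² and a₁a₂. (This is the corrected form of the first part of Lemma 3.3 of Grant–Lupton–Oprea: for classes a ∈ H*(X;k) of degree |a|, setting aᵢ = 1⊗⋯⊗a⊗⋯⊗1 ∈ H*(X;k)^{⊗n} with a in the i-th slot and ε = (−1)^{|a|²}, it states that (a₁−a₂)⋯(a₁−aₙ) ≡ (−1)ⁿ(a⊗1 − 1⊗a)⊗a⊗⋯⊗a modulo the ideal generated by a²⊗1⊗⋯⊗1 and a⊗a⊗1⊗⋯⊗1.) -/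
theorem aux_list {R : Type*} [Ring R] (b : R) (l : List R)
    (h : ∀ x ∈ l, x * b = b * x ∨ x * b = -(b * x)) :
    l.prod * b = b * l.prod ∨ l.prod * b = -(b * l.prod) := by
  induction l with
  | nil => simp
  | cons x l ih =>
    have hx := h x (by simp)
    have hl := ih (fun y hy => h y (by simp [hy]))
    rw [List.prod_cons]
    rcases hx with hx | hx <;> rcases hl with hl | hl <;>
      simp [mul_assoc, hl, ← mul_assoc x b, hx]

/-- Corrected form of the first part of Lemma 3.3 of Grant–Lupton–Oprea:
for a ring `R`, `n ≥ 2`, elements `a 1, …, a n` of `R` pairwise commuting up to a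
fixed sign `ε ∈ {1, −1}`, the element
`(a₁ − a₂)(a₁ − a₃)⋯(a₁ − aₙ) − (−1)ⁿ·(a₁ − a₂)·a₃a₄⋯aₙ`
lies in the two-sided ideal generated by `a₁²` and `a₁a₂`. -/
theorem grant_lemma_first_part_corrected
    (R : Type*) [Ring R] (n : ℕ) (hn : 2 ≤ n) (a : ℕ → R) (ε : R)
    (hε : ε = 1 ∨ ε = -1)
    (hcomm : ∀ i ∈ Finset.Icc 1 n, ∀ j ∈ Finset.Icc 1 n, i ≠ j →
      a i * a j = ε * (a j * a i)) :
    ((List.Ico 2 (n + 1)).map (fun i => a 1 - a i)).prod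
      - (-1 : R) ^ n * ((a 1 - a 2) * ((List.Ico 3 (n + 1)).map a).prod)
      ∈ TwoSidedIdeal.span {a 1 ^ 2, a 1 * a 2} := by
  induction n, hn using Nat.le_induction with
  | base =>
    have h1 : List.Ico 2 (2 + 1) = [2] := rfl
    have h2 : List.Ico 3 (2 + 1) = [] := rfl
    rw [h1, h2]
    simp [TwoSidedIdeal.zero_mem]
  | succ n hn ih =>
    have hI := ih (fun i hi j hj hij => hcomm i
      (by simp only [Finset.mem_Icc] at hi ⊢; omega) j
      (by simp only [Finset.mem_Icc] at hj ⊢; omega) hij)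
    rw [List.Ico.succ_top (show 2 ≤ n + 1 by omega),
      List.Ico.succ_top (show 3 ≤ n + 1 by omega)]
    simp only [List.map_append, List.prod_append, List.map_cons, List.map_nil, List.prod_cons,
      List.prod_nil, mul_one]
    have hs : ∀ i ∈ Finset.Icc 2 (n + 1), a i * a 1 = a 1 * a i ∨ a i * a 1 = -(a 1 * a i) := by
      intro i hi
      simp only [Finset.mem_Icc] at hi
      have := hcomm i (by simp only [Finset.mem_Icc]; omega) 1
        (by simp only [Finset.mem_Icc]; omega) (by omega)
      rcases hε with rfl | rfl
      · left; simpa using this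
      · right; simpa using this
    have hQ := aux_list (a 1) ((List.Ico 3 (n + 1)).map a) (by
      intro x hx
      simp only [List.mem_map, List.Ico.mem] at hx
      obtain ⟨i, hi, rfl⟩ := hx
      exact hs i (by simp only [Finset.mem_Icc]; omega))
    have h12 := hs 2 (by simp only [Finset.mem_Icc]; omega)
    generalize ((List.Ico 3 (n + 1)).map a).prod = Q at *
    generalize ((List.Ico 2 (n + 1)).map (fun i => a 1 - a i)).prod = P at *
    set I := TwoSidedIdeal.span {a 1 ^ 2, a 1 * a 2} with hIdef
    have m1 : a 1 * a 1 ∈ I := by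
      rw [← pow_two]; exact TwoSidedIdeal.subset_span (by simp)
    have m2 : a 1 * a 2 ∈ I := TwoSidedIdeal.subset_span (by simp)
    have m3 : (a 1 - a 2) * a 1 ∈ I := by
      rw [sub_mul]
      refine I.sub_mem m1 ?_
      rcases h12 with h | h <;> rw [h]
      · exact m2
      · exact I.neg_mem m2
    have m4 : (a 1 - a 2) * (Q * a 1) ∈ I := by
      have := I.mul_mem_right _ Q m3
      rw [mul_assoc] at this
      rcases hQ with h | h <;> rw [h]
      · exact this
      · rw [mul_neg]; exact I.neg_mem this
    have key := I.add_mem (I.mul_mem_right _ (a 1 - a (n + 1)) hI)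
      (I.mul_mem_left ((-1) ^ n) _ m4)
    convert key using 1
    rw [pow_succ]
    noncomm_ring
end

section
/- Let R be a (not necessarily commutative) ring, let n ≥ 2, let a₁, …, aₙ, b₁, b₂ ∈ R, and let ε, δ ∈ {1, −1} be such that aᵢaⱼ = ε·aⱼaᵢ for all i ≠ j, b₁aᵢ = δ·aᵢb₁ for all i ≥ 2, and b₂aᵢ = δ·aᵢb₂ for all i ≠ 2. Then the element (b₁ − b₂)(a₁ − a₂)(a₁ − a₃)⋯(a₁ − aₙ) − (−1)^{n+1}·(b₁a₂ + b₂a₁)·a₃a₄⋯aₙ lies in the two-sided ideal of R generated by a₁², b₁a₁, and b₂a₂. (This is the second part of Lemma 3.3 of Grant–Lupton–Oprea: for classes a, b ∈ H*(X;k), setting aᵢ = 1⊗⋯⊗a⊗⋯⊗1 and bᵢ = 1⊗⋯⊗b⊗⋯⊗1 in H*(X;k)^{⊗n}, with ε = (−1)^{|a||a|} and δ = (−1)^{|a||b|}, it states that (b₁−b₂)(a₁−a₂)⋯(a₁−aₙ) ≡ (−1)^{n+1}(b⊗a + (−1)^{|a||b|}a⊗b)⊗a⊗⋯⊗a modulo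 the ideal generated by a²⊗1⊗⋯⊗1, ba⊗1⊗⋯⊗1, and 1⊗ba⊗1⊗⋯⊗1.) -/
/-- Second part of Lemma 3.3 of Grant–Lupton–Oprea: for a ring `R`, `n ≥ 2`,
elements `a 1, …, a n, b 1, b 2` of `R` with `aᵢaⱼ = ε·aⱼaᵢ` for `i ≠ j`,
`b₁aᵢ = δ·aᵢb₁` for `i ≥ 2`, and `b₂aᵢ = δ·aᵢb₂` for `i ≠ 2`
(with signs `ε, δ ∈ {1, −1}`), the element
`(b₁ − b₂)(a₁ − a₂)(a₁ − a₃)⋯(a₁ − aₙ) − (−1)^{n+1}·(b₁a₂ + b₂a₁)·a₃a₄⋯aₙ`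
lies in the two-sided ideal generated by `a₁²`, `b₁a₁`, and `b₂a₂`. -/
theorem grant_lemma_second_part
    (R : Type*) [Ring R] (n : ℕ) (hn : 2 ≤ n) (a b : ℕ → R) (ε δ : R)
    (hε : ε = 1 ∨ ε = -1) (hδ : δ = 1 ∨ δ = -1)
    (hcomm : ∀ i ∈ Finset.Icc 1 n, ∀ j ∈ Finset.Icc 1 n, i ≠ j →
      a i * a j = ε * (a j * a i))
    (hb1 : ∀ i ∈ Finset.Icc 2 n, b 1 * a i = δ * (a i * b 1))
    (hb2 : ∀ i ∈ Finset.Icc 1 n, i ≠ 2 → b 2 * a i = δ * (a i * b 2)) :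
    (b 1 - b 2) * ((List.Ico 2 (n + 1)).map (fun i => a 1 - a i)).prod
      - (-1 : R) ^ (n + 1) *
        ((b 1 * a 2 + b 2 * a 1) * ((List.Ico 3 (n + 1)).map a).prod)
      ∈ TwoSidedIdeal.span {a 1 ^ 2, b 1 * a 1, b 2 * a 2} := by
  set I := TwoSidedIdeal.span {a 1 ^ 2, b 1 * a 1, b 2 * a 2} with hI
  have h1 : a 1 ^ 2 ∈ I := TwoSidedIdeal.subset_span (by simp)
  have h2 : b 1 * a 1 ∈ I := TwoSidedIdeal.subset_span (by simp)
  have h3 : b 2 * a 2 ∈ I := TwoSidedIdeal.subset_span (by simp)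
  have sgn : ∀ i ∈ Finset.Icc 2 n, ∀ x : R, x * a 1 ∈ I → x * (a i * a 1) ∈ I := by
    intro i hi x hx
    rw [Finset.mem_Icc] at hi
    have h := hcomm i (Finset.mem_Icc.2 ⟨by omega, hi.2⟩) 1
      (Finset.mem_Icc.2 ⟨le_refl _, by omega⟩) (by omega)
    have hy : x * (a 1 * a i) ∈ I := by
      rw [← mul_assoc]
      exact I.mul_mem_right _ _ hx
    rw [h]
    rcases hε with rfl | rfl
    · simpa using hy
    · simpa using hy
  have key : ∀ m, 2 ≤ m → m ≤ n →
      ((b 1 * a 2 + b 2 * a 1) * ((List.Ico 3 (m + 1)).map a).prod) * a 1 ∈ I := by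
    intro m hm
    induction m, hm using Nat.le_induction with
    | base =>
      intro _
      have e : ((b 1 * a 2 + b 2 * a 1) * ((List.Ico 3 (2 + 1)).map a).prod) * a 1
          = b 1 * (a 2 * a 1) + b 2 * a 1 ^ 2 := by
        simp
        noncomm_ring
      rw [e]
      exact I.add_mem (sgn 2 (Finset.mem_Icc.2 ⟨le_refl _, hn⟩) _ h2) (I.mul_mem_left _ _ h1)
    | succ m hm ih =>
      intro hmn
      rw [List.Ico.succ_top (show 3 ≤ m + 1 by omega)]
      simp only [List.map_append, List.prod_append, List.map_cons, List.map_nil,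
        List.prod_singleton]
      have := sgn (m + 1) (Finset.mem_Icc.2 ⟨by omega, hmn⟩) _ (ih (by omega))
      simpa only [mul_assoc] using this
  have main : ∀ m, 2 ≤ m → m ≤ n →
      (b 1 - b 2) * ((List.Ico 2 (m + 1)).map (fun i => a 1 - a i)).prod
      - (-1 : R) ^ (m + 1) *
        ((b 1 * a 2 + b 2 * a 1) * ((List.Ico 3 (m + 1)).map a).prod) ∈ I := by
    intro m hm
    induction m, hm using Nat.le_induction with
    | base =>
      intro _
      have e : (b 1 - b 2) * ((List.Ico 2 (2 + 1)).map (fun i => a 1 - a i)).prod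
          - (-1 : R) ^ (2 + 1) *
          ((b 1 * a 2 + b 2 * a 1) * ((List.Ico 3 (2 + 1)).map a).prod)
          = b 1 * a 1 + b 2 * a 2 := by
        rw [List.Ico.succ_singleton, List.Ico.self_empty]
        simp only [List.map_cons, List.map_nil, List.prod_singleton, List.prod_nil]
        noncomm_ring
      rw [e]
      exact I.add_mem h2 h3
    | succ m hm ih =>
      intro hmn
      rw [List.Ico.succ_top (show 3 ≤ m + 1 by omega),
        List.Ico.succ_top (show 2 ≤ m + 1 by omega)]
      simp only [List.map_append, List.prod_append, List.map_cons, List.map_nil,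
        List.prod_singleton]
      have k := I.mul_mem_left ((-1) ^ (m + 1)) _ (key m hm (by omega))
      have i := I.mul_mem_right _ (a 1 - a (m + 1)) (ih (by omega))
      have := I.add_mem i k
      convert this using 1
      rw [pow_succ (-1 : R) (m + 1)]
      generalize (-1 : R) ^ (m + 1) = s
      generalize ((List.Ico 3 (m + 1)).map a).prod = p
      generalize ((List.Ico 2 (m + 1)).map (fun i => a 1 - a i)).prod = q
      generalize b 1 * a 2 + b 2 * a 1 = c
      noncomm_ring
  exact main n hn le_rfl
end

section
/- In the polynomial ring ℚ[x₁, x₂, x₃, x₄], the element (x₁ − x₂)(x₁ − x₃)(x₁ − x₄) − (x₁ − x₂)·x₃·x₄ does NOT lie in the ideal generated by x₁² and x₁x₂x₃. (This exhibits the failure, for n = 4 and a class a of even degree, of the original formulation of Lemma 3.3(1) in Grant–Lupton–Oprea, which claimed that (a₁−a₂)(a₁−a₃)(a₁−a₄) ≡ (−1)⁴(a⊗1 − 1⊗a)⊗a⊗a modulo the ideal of H*(X;k)^{⊗4} generated by a²⊗1⊗1⊗1 and a⊗a⊗a⊗1.) -/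
open MvPolynomial

/-- Counterexample to the original formulation of Lemma 3.3(1) of
Grant–Lupton–Oprea for `n = 4`: in `ℚ[x₁, x₂, x₃, x₄]`, the element
`(x₁ − x₂)(x₁ − x₃)(x₁ − x₄) − (x₁ − x₂)·x₃·x₄` does not lie in the ideal
generated by `x₁²` and `x₁x₂x₃`. -/
theorem counterexample_original_lemma :
    ((X 0 - X 1) * (X 0 - X 2) * (X 0 - X 3)
        - (X 0 - X 1) * X 2 * X 3 : MvPolynomial (Fin 4) ℚ)
      ∉ Ideal.span {(X 0 ^ 2 : MvPolynomial (Fin 4) ℚ), X 0 * X 1 * X 2} := by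
  intro h
  let f : MvPolynomial (Fin 4) ℚ →ₐ[ℚ] DualNumber ℚ :=
    aeval ![DualNumber.eps, 1, 0, 1]
  have e0 : f (X 0) = DualNumber.eps := by simp [f]
  have e1 : f (X 1) = 1 := by simp [f]
  have e2 : f (X 2) = 0 := by simp [f]
  have e3 : f (X 3) = 1 := by simp [f]
  obtain ⟨a, b, hab⟩ := Ideal.mem_span_pair.mp h
  have h2 := congrArg f hab
  simp only [map_add, map_mul, map_sub, map_pow, e0, e1, e2, e3] at h2
  have h3 := congrArg TrivSqZeroExt.snd h2
  simp [pow_two] at h3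
end

section
/- Let R be a (not necessarily commutative) ring, let n ≥ 2, let a₁, …, aₙ ∈ R, and let ε ∈ {1, −1} be such that aᵢaⱼ = ε·aⱼaᵢ for all i ≠ j. Then the element (a₁ − a₂)(a₁ − a₃)⋯(a₁ − aₙ) − ( (−1)^{n}·a₁·a₃·a₄⋯aₙ − (−1)^{n}·a₂·a₃⋯aₙ ) lies in the two-sided ideal of R generated by a₁² and a₁a₂; equivalently, modulo that ideal, (a₁−a₂)(a₁−a₃)⋯(a₁−aₙ) is congruent to (−1)ⁿ(a₁a₃⋯aₙ − a₂a₃⋯aₙ). -/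
/-- For a ring `R`, `n ≥ 2`, and elements `a 1, …, a n` of `R` pairwise
commuting up to a fixed sign `ε ∈ {1, −1}`, the element
`(a₁ − a₂)(a₁ − a₃)⋯(a₁ − aₙ) − ((−1)ⁿ·a₁·a₃·a₄⋯aₙ − (−1)ⁿ·a₂·a₃⋯aₙ)`
lies in the two-sided ideal generated by `a₁²` and `a₁a₂`. -/
theorem grant_lemma_first_part_explicit
    (R : Type*) [Ring R] (n : ℕ) (hn : 2 ≤ n) (a : ℕ → R) (ε : R)
    (hε : ε = 1 ∨ ε = -1)
    (hcomm : ∀ i ∈ Finset.Icc 1 n, ∀ j ∈ Finset.Icc 1 n, i ≠ j →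
      a i * a j = ε * (a j * a i)) :
    ((List.Ico 2 (n + 1)).map (fun i => a 1 - a i)).prod
      - ((-1 : R) ^ n * (a 1 * ((List.Ico 3 (n + 1)).map a).prod)
        - (-1 : R) ^ n * (a 2 * ((List.Ico 3 (n + 1)).map a).prod))
      ∈ TwoSidedIdeal.span {a 1 ^ 2, a 1 * a 2} := by
  have key : ∀ m, 2 ≤ m → m ≤ n →
      ((a 1 - a 2) * ((List.Ico 3 (m + 1)).map a).prod * a 1
        ∈ TwoSidedIdeal.span {a 1 ^ 2, a 1 * a 2}) ∧
      (((List.Ico 2 (m + 1)).map (fun i => a 1 - a i)).prod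
        - (-1 : R) ^ m * ((a 1 - a 2) * ((List.Ico 3 (m + 1)).map a).prod)
        ∈ TwoSidedIdeal.span {a 1 ^ 2, a 1 * a 2}) := by
    intro m hm
    induction m, hm using Nat.le_induction with
    | base =>
      intro _
      have e1 : List.Ico 3 (2 + 1) = [] := by decide
      have e2 : List.Ico 2 (2 + 1) = [2] := by decide
      rw [e1, e2]
      have h1 : a 1 ^ 2 ∈ TwoSidedIdeal.span {a 1 ^ 2, a 1 * a 2} :=
        TwoSidedIdeal.subset_span (by simp)
      have h2 : a 1 * a 2 ∈ TwoSidedIdeal.span {a 1 ^ 2, a 1 * a 2} :=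
        TwoSidedIdeal.subset_span (by simp)
      have hc := hcomm 2 (by simp; omega) 1 (by simp; omega) (by decide)
      constructor
      · have : (a 1 - a 2) * (List.map a []).prod * a 1 = a 1 ^ 2 - ε * (a 1 * a 2) := by
          rw [← hc]; simp only [List.map_nil, List.prod_nil]; noncomm_ring
        rw [this]
        exact TwoSidedIdeal.sub_mem _ h1 (TwoSidedIdeal.mul_mem_left _ _ _ h2)
      · simp [TwoSidedIdeal.zero_mem]
    | succ m hm ih =>
      intro hmn
      obtain ⟨ih1, ih2⟩ := ih (by omega)
      rw [List.Ico.succ_top (show 3 ≤ m + 1 by omega),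
        List.Ico.succ_top (show 2 ≤ m + 1 by omega)]
      simp only [List.map_append, List.prod_append, List.map_cons, List.map_nil,
        List.prod_singleton]
      have hc := hcomm (m + 1) (by simp; omega) 1 (by simp; omega) (by omega)
      generalize ((List.Ico 3 (m + 1)).map a).prod = A at *
      generalize ((List.Ico 2 (m + 1)).map (fun i => a 1 - a i)).prod = P at *
      constructor
      · have h3 := TwoSidedIdeal.mul_mem_right _ _ (a (m + 1)) ih1
        have e : (a 1 - a 2) * (A * a (m + 1)) * a 1
            = (a 1 - a 2) * A * (a (m + 1) * a 1) := by noncomm_ring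
        rw [e, hc]
        rcases hε with h | h
        · rw [h, one_mul, ← mul_assoc]; exact h3
        · rw [h, neg_one_mul, mul_neg, ← mul_assoc]; exact TwoSidedIdeal.neg_mem _ h3
      · have h3 := TwoSidedIdeal.mul_mem_right _ _ (a 1 - a (m + 1)) ih2
        have h4 := TwoSidedIdeal.mul_mem_left _ ((-1 : R) ^ m) _ ih1
        have h5 := TwoSidedIdeal.add_mem _ h3 h4
        convert h5 using 1
        rw [pow_succ]
        generalize (-1 : R) ^ m = s
        noncomm_ring
  have h := (key n hn le_rfl).2
  rwa [sub_mul, mul_sub] at h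
end
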